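/- Let q be a prime power, n ≥ 1, t ≥ 1, and J ⊆ [n-1]. Then the rank-selected invariant of the t-fold Segre power of the subspace lattice satisfies β̃_{B_n^{(t)}(q)}(J) = Σ Π_{i=1}^t q^{inv(σ^i)}, where the sum is over all t-tuples (σ^1,…,σ^t) of permutations in S_n such that the intersection Asc(σ^1) ∩ ⋯ ∩ Asc(σ^t) of their ascent sets equals the complement [n-1] \ J, and inv(σ) denotes the number of inversions of σ. -/

import Mathlib

open scoped Classical

/-- Saturated (maximal) chains of length `r` from `a` to `b` in a poset. -/
def maxChains {α : Type*} [PartialOrder α] (a b : α) (r : ℕ) : Set (Fin (r + 1) → α) :=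
  {c | c 0 = a ∧ c (Fin.last r) = b ∧ ∀ j : Fin r, c j.castSucc ⋖ c j.succ}

/-- The word of edge labels of a chain. -/
def chainWord {α Λ : Type*} (lab : α → α → Λ) {r : ℕ} (c : Fin (r + 1) → α) : List Λ :=
  List.ofFn fun j : Fin r => lab (c j.castSucc) (c j.succ)

/-- The chain `c` has an ascent at position `i ∈ [r-1]` (1-indexed). -/
def IsAscentAt {α Λ : Type*} [Preorder Λ] (lab : α → α → Λ) {r : ℕ}
    (c : Fin (r + 1) → α) (i : ℕ) : Prop :=
  ∃ h : 1 ≤ i ∧ i < r,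
    lab (c ⟨i - 1, by omega⟩) (c ⟨i, by omega⟩) < lab (c ⟨i, by omega⟩) (c ⟨i + 1, by omega⟩)

/-- The chain `c` has a descent at position `i ∈ [r-1]` (1-indexed). -/
def IsDescentAt {α Λ : Type*} [Preorder Λ] (lab : α → α → Λ) {r : ℕ}
    (c : Fin (r + 1) → α) (i : ℕ) : Prop :=
  ∃ h : 1 ≤ i ∧ i < r,
    ¬ lab (c ⟨i - 1, by omega⟩) (c ⟨i, by omega⟩) < lab (c ⟨i, by omega⟩) (c ⟨i + 1, by omega⟩)

/-- The ascent set of a chain. -/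
def ascSet {α Λ : Type*} [Preorder Λ] (lab : α → α → Λ) {r : ℕ} (c : Fin (r + 1) → α) : Set ℕ :=
  {i | IsAscentAt lab c i}

/-- The descent set of a chain. -/
def desSet {α Λ : Type*} [Preorder Λ] (lab : α → α → Λ) {r : ℕ} (c : Fin (r + 1) → α) : Set ℕ :=
  {i | IsDescentAt lab c i}

/-- An EL-labeling: in every interval `[x, y]` there is a unique increasing maximal chain, and
it lexicographically strictly precedes every other maximal chain of the interval.  (In a graded
poset with rank function `rk`, every maximal chain of `[x, y]` has length `rk y - rk x`.) -/
def IsELLabeling {α Λ : Type*} [PartialOrder α] [Preorder Λ] (rk : α → ℕ) (lab : α → α → Λ) :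
    Prop :=
  ∀ x y : α, x ≤ y →
    ∃ c ∈ maxChains x y (rk y - rk x),
      (chainWord lab c).Chain' (· < ·) ∧
        ∀ c' ∈ maxChains x y (rk y - rk x), c' ≠ c →
          ¬ (chainWord lab c').Chain' (· < ·) ∧
            List.Lex (· < ·) (chainWord lab c) (chainWord lab c')

/-- The `t`-fold Segre power of a poset with rank function `rk`: tuples of equal rank, with the
order induced from the product order. -/
abbrev SegrePower {α : Type*} [PartialOrder α] (rk : α → ℕ) (t : ℕ) : Type _ :=
  {x : Fin t → α // ∀ i j, rk (x i) = rk (x j)}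

/-- The componentwise edge labeling of the Segre power induced by an edge labeling of `P`. -/
def segreLab {α Λ : Type*} [PartialOrder α] (rk : α → ℕ) (t : ℕ) (lab : α → α → Λ) :
    SegrePower rk t → SegrePower rk t → (Fin t → Λ) :=
  fun X Y i => lab (X.1 i) (Y.1 i)


/-- The rank-selected subposet determined by the rank set `J`: the elements whose rank lies in
`J`, together with the bottom element `b` and the top element `tp`. -/
abbrev RankSel {α : Type*} [PartialOrder α] (rk : α → ℕ) (b tp : α) (J : Finset ℕ) : Type _ :=
  {x : α // rk x ∈ J ∨ x = b ∨ x = tp}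

/-- The rank-selected invariant `α̃(J)`: the number of maximal chains of the rank-selected
subposet (each such chain has length `|J| + 1`). -/
noncomputable def alphaT {α : Type*} [PartialOrder α] (rk : α → ℕ) (b tp : α) (J : Finset ℕ) :
    ℕ :=
  (maxChains (⟨b, Or.inr (Or.inl rfl)⟩ : RankSel rk b tp J)
    ⟨tp, Or.inr (Or.inr rfl)⟩ (J.card + 1)).ncard

/-- The rank-selected invariant `β̃(J) = Σ_{U ⊆ J} (-1)^{|J| - |U|} α̃(U)`. -/
noncomputable def betaT {α : Type*} [PartialOrder α] (rk : α → ℕ) (b tp : α) (J : Finset ℕ) :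
    ℤ :=
  ∑ U ∈ J.powerset, (-1 : ℤ) ^ (J.card - U.card) * alphaT rk b tp U

/-- The ascent set of a permutation `σ ∈ S_n` (1-indexed): the positions `i ∈ [n-1]` with
`σ(i) < σ(i+1)`. -/
def permAsc {n : ℕ} (σ : Equiv.Perm (Fin n)) : Set ℕ :=
  {i | ∃ h : 1 ≤ i ∧ i < n, σ ⟨i - 1, by omega⟩ < σ ⟨i, by omega⟩}

/-- The number of inversions of a permutation `σ ∈ S_n`:
`inv(σ) = |{(i, j) : i < j, σ(i) > σ(j)}|`. -/
noncomputable def permInv {n : ℕ} (σ : Equiv.Perm (Fin n)) : ℕ :=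
  Set.ncard {p : Fin n × Fin n | p.1 < p.2 ∧ σ p.2 < σ p.1}

/-! ### Subset side of the Gaussian binomial coefficient -/

/-- The number of pairs `(s, c)` with `s ∈ S`, `c ∉ S` and `c < s`. -/
def subsetInv (S : Finset ℕ) : ℕ := ∑ s ∈ S, (Finset.range s \ S).card

/-- The Gaussian binomial coefficient as the generating function of `m`-subsets of
`{0, …, n - 1}` by `subsetInv`. -/
def gaussBinom (q n m : ℕ) : ℕ :=
  ∑ S ∈ (Finset.range n).powersetCard m, q ^ subsetInv S

lemma subsetInv_insert {n m : ℕ} {S : Finset ℕ} (hS : S ∈ (Finset.range n).powersetCard m) :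
    subsetInv (insert n S) = subsetInv S + (n - m) := by
  obtain ⟨hsub, hcard⟩ := Finset.mem_powersetCard.1 hS
  have hn : n ∉ S := fun h => by simpa using hsub h
  rw [subsetInv, Finset.sum_insert hn, add_comm]
  congr 1
  · refine Finset.sum_congr rfl fun s hs => ?_
    congr 1
    ext x
    have := Finset.mem_range.1 (hsub hs)
    simp only [Finset.mem_sdiff, Finset.mem_range, Finset.mem_insert]
    constructor
    · rintro ⟨h1, h2⟩
      exact ⟨h1, fun h => h2 (Or.inr h)⟩
    · rintro ⟨h1, h2⟩
      exact ⟨h1, by rintro (h | h); · omega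
                    · exact h2 h⟩
  · rw [Finset.sdiff_insert_of_notMem (by simp), Finset.card_sdiff_of_subset hsub,
      Finset.card_range, hcard]

lemma gaussBinom_zero_right (q n : ℕ) : gaussBinom q n 0 = 1 := by
  simp [gaussBinom, subsetInv]

lemma gaussBinom_eq_zero (q : ℕ) {n m : ℕ} (h : n < m) : gaussBinom q n m = 0 := by
  rw [gaussBinom, Finset.powersetCard_eq_empty.2 (by simpa using h), Finset.sum_empty]

lemma gaussBinom_succ (q n m : ℕ) :
    gaussBinom q (n + 1) (m + 1) = gaussBinom q n (m + 1) + q ^ (n - m) * gaussBinom q n m := by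
  have hn : n ∉ Finset.range n := by simp
  have hmem : ∀ S ∈ (Finset.range n).powersetCard m, n ∉ S := fun S hS h => by
    simpa using (Finset.mem_powersetCard.1 hS).1 h
  rw [gaussBinom, Finset.range_add_one, Finset.powersetCard_succ_insert hn, Finset.sum_union,
    Finset.sum_image]
  · congr 1
    rw [gaussBinom, Finset.mul_sum]
    refine Finset.sum_congr rfl fun S hS => ?_
    rw [subsetInv_insert hS, pow_add, mul_comm]
  · intro S hS T hT h
    rw [← Finset.erase_insert (hmem S hS), ← Finset.erase_insert (hmem T hT)]
    exact congrArg (fun R => Finset.erase R n) h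
  · rw [Finset.disjoint_left]
    intro S hS hS'
    obtain ⟨T, -, rfl⟩ := Finset.mem_image.1 hS'
    exact hn ((Finset.mem_powersetCard.1 hS).1 (Finset.mem_insert_self n T))

lemma prod_pow_sub_pow_succ (Q : ℤ) (n m : ℕ) :
    ∏ i ∈ Finset.range (m + 1), (Q ^ (n + 1) - Q ^ i) =
      (Q ^ (n + 1) - 1) * Q ^ m * ∏ i ∈ Finset.range m, (Q ^ n - Q ^ i) := by
  rw [Finset.prod_range_succ', pow_zero]
  have : ∀ i, Q ^ (n + 1) - Q ^ (i + 1) = Q * (Q ^ n - Q ^ i) := fun i => by ring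
  simp only [this, Finset.prod_mul_distrib, Finset.prod_const, Finset.card_range]
  ring

lemma gaussBinom_mul_prod (q n m : ℕ) :
    (gaussBinom q n m : ℤ) * ∏ i ∈ Finset.range m, ((q : ℤ) ^ m - (q : ℤ) ^ i) =
      ∏ i ∈ Finset.range m, ((q : ℤ) ^ n - (q : ℤ) ^ i) := by
  induction n generalizing m with
  | zero =>
    cases m with
    | zero => simp [gaussBinom_zero_right]
    | succ m =>
      rw [gaussBinom_eq_zero q m.succ_pos, Finset.prod_eq_zero (i := 0)
        (s := Finset.range (m + 1)) (f := fun i => (q : ℤ) ^ 0 - (q : ℤ) ^ i)] <;> simp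
  | succ n ih =>
    cases m with
    | zero => simp [gaussBinom_zero_right]
    | succ m =>
      have h1 := ih (m + 1)
      have h2 := ih m
      rw [prod_pow_sub_pow_succ] at h1
      rw [prod_pow_sub_pow_succ, prod_pow_sub_pow_succ, gaussBinom_succ, ← h2]
      rw [Finset.prod_range_succ, ← h2] at h1
      push_cast
      rw [add_mul, h1]
      rcases lt_or_ge n m with hnm | hnm
      · simp [gaussBinom_eq_zero q hnm]
      · obtain ⟨k, rfl⟩ := Nat.exists_eq_add_of_le hnm
        rw [Nat.add_sub_cancel_left]
        ring

/-! ### Subspace side of the Gaussian binomial coefficient -/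

section Subspaces

variable {F V : Type*} [Field F] [AddCommGroup V] [Module F V]

lemma span_range_coe_eq [FiniteDimensional F V] {m : ℕ} {W : Submodule F V}
    (hW : Module.finrank F W = m) {s : Fin m → W} (hs : LinearIndependent F s) :
    Submodule.span F (Set.range fun i => (s i : V)) = W := by
  apply Submodule.eq_of_le_of_finrank_eq
  · rw [Submodule.span_le]
    rintro _ ⟨i, rfl⟩
    exact (s i).2
  · have := finrank_span_eq_card (hs.map' W.subtype (Submodule.ker_subtype _))
    rw [Fintype.card_fin] at this
    exact this.trans hW.symm

lemma sigma_tuple_ext {m : ℕ}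
    {p p' : Σ W : {W : Submodule F V // Module.finrank F W = m},
        {s : Fin m → W.1 // LinearIndependent F s}}
    (h : p.1.1 = p'.1.1) (h' : ∀ i, (p.2.1 i : V) = p'.2.1 i) : p = p' := by
  obtain ⟨⟨W, hW⟩, ⟨s, hs⟩⟩ := p
  obtain ⟨⟨W', hW'⟩, ⟨s', hs'⟩⟩ := p'
  obtain rfl : W = W' := h
  obtain rfl : s = s' := funext fun i => Subtype.ext (h' i)
  rfl

/-- A linearly independent `m`-tuple amounts to an `m`-dimensional subspace together with a
linearly independent `m`-tuple of that subspace. -/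
noncomputable def linearIndependentEquivSigma [FiniteDimensional F V] (m : ℕ) :
    {s : Fin m → V // LinearIndependent F s} ≃
      Σ W : {W : Submodule F V // Module.finrank F W = m},
        {s : Fin m → W.1 // LinearIndependent F s} where
  toFun s := ⟨⟨Submodule.span F (Set.range s.1), by simp [finrank_span_eq_card s.2]⟩,
    ⟨_, linearIndependent_span s.2⟩⟩
  invFun p := ⟨fun i => (p.2.1 i : V),
    p.2.2.map' p.1.1.subtype (Submodule.ker_subtype _)⟩
  left_inv s := rfl
  right_inv p := sigma_tuple_ext (span_range_coe_eq p.1.2 p.2.2) fun _ => rfl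

lemma card_linearIndependent_int [Fintype F] [Finite V] {m : ℕ} (hm : m ≤ Module.finrank F V) :
    (Nat.card {s : Fin m → V // LinearIndependent F s} : ℤ) =
      ∏ i ∈ Finset.range m,
        ((Fintype.card F : ℤ) ^ Module.finrank F V - (Fintype.card F : ℤ) ^ i) := by
  rw [card_linearIndependent hm, Nat.cast_prod, Finset.prod_range]
  refine Finset.prod_congr rfl fun i _ => ?_
  rw [Nat.cast_sub (Nat.pow_le_pow_right Fintype.card_pos (i.2.le.trans hm))]
  push_cast
  rfl

lemma card_submodule_finrank_eq [Fintype F] [Finite V] {m : ℕ} (hm : m ≤ Module.finrank F V) :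
    Nat.card {W : Submodule F V // Module.finrank F W = m} =
      gaussBinom (Fintype.card F) (Module.finrank F V) m := by
  have hfd : FiniteDimensional F V := Module.Finite.of_finite
  have h := card_linearIndependent_int hm
  have : Fintype {W : Submodule F V // Module.finrank F W = m} := Fintype.ofFinite _
  rw [Nat.card_congr (linearIndependentEquivSigma m), Nat.card_sigma, Nat.cast_sum,
    Finset.sum_congr rfl fun W _ => by
      rw [card_linearIndependent_int W.2.ge, W.2], Finset.sum_const, Finset.card_univ,
    ← Nat.card_eq_fintype_card, ← gaussBinom_mul_prod _ (Module.finrank F V), nsmul_eq_mul] at h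
  have hne : ∏ i ∈ Finset.range m, ((Fintype.card F : ℤ) ^ m - (Fintype.card F : ℤ) ^ i) ≠ 0 := by
    rw [Finset.prod_ne_zero_iff]
    intro i hi
    have := Nat.pow_lt_pow_right (Fintype.one_lt_card (α := F)) (Finset.mem_range.1 hi)
    rw [sub_ne_zero]
    exact_mod_cast this.ne'
  exact_mod_cast mul_right_cancel₀ hne h

/-- The flags of subspaces whose set of dimensions is `U`. -/
abbrev FlagOfDims (F V : Type*) [Field F] [AddCommGroup V] [Module F V] (U : Finset ℕ) : Type _ :=
  {f : U → Submodule F V // Monotone f ∧ ∀ u, Module.finrank F (f u) = u}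

lemma sigma_flag_ext {m : ℕ} {U : Finset ℕ}
    {p p' : Σ W : {W : Submodule F V // Module.finrank F W = m}, FlagOfDims F W.1 U}
    (h : p.1.1 = p'.1.1)
    (h' : ∀ u, (p.2.1 u).map p.1.1.subtype = (p'.2.1 u).map p'.1.1.subtype) : p = p' := by
  obtain ⟨⟨W, hW⟩, ⟨s, hs⟩⟩ := p
  obtain ⟨⟨W', hW'⟩, ⟨s', hs'⟩⟩ := p'
  obtain rfl : W = W' := h
  obtain rfl : s = s' := funext fun i =>
    Submodule.map_injective_of_injective W.injective_subtype (h' i)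
  rfl

/-- A flag amounts to its largest member together with a flag inside that member. -/
noncomputable def flagInsertEquiv [FiniteDimensional F V] {m : ℕ} {U : Finset ℕ}
    (hU : ∀ u ∈ U, u < m) :
    FlagOfDims F V (insert m U) ≃
      Σ W : {W : Submodule F V // Module.finrank F W = m}, FlagOfDims F W.1 U where
  toFun f := ⟨⟨f.1 ⟨m, Finset.mem_insert_self m U⟩, f.2.2 _⟩,
    ⟨fun u => (f.1 ⟨u, Finset.mem_insert_of_mem u.2⟩).comap (Submodule.subtype _),
      fun u v huv => Submodule.comap_mono (f.2.1 huv), fun u => by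
        rw [← Submodule.finrank_map_subtype_eq, Submodule.map_comap_subtype,
          inf_eq_right.2 (f.2.1 (Subtype.mk_le_mk.2 (hU u u.2).le)), f.2.2]⟩⟩
  invFun p := ⟨fun u => if h : (u : ℕ) ∈ U then (p.2.1 ⟨u, h⟩).map p.1.1.subtype else p.1.1, by
    constructor
    · rintro ⟨u, hu⟩ ⟨v, hv⟩ huv
      have huv' : u ≤ v := huv
      by_cases h : v ∈ U
      · have h' : u ∈ U := (Finset.mem_insert.1 hu).resolve_left fun h' => by
          have := hU v h; omega
        simp only [h, h', dif_pos]
        exact Submodule.map_mono (p.2.2.1 huv')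
      · simp only [h, dif_neg, not_false_eq_true]
        split_ifs
        · exact Submodule.map_subtype_le _ _
        · exact le_rfl
    · rintro ⟨u, hu⟩
      by_cases h : u ∈ U
      · exact ((congrArg (fun X : Submodule F V => Module.finrank F X) (dif_pos h)).trans
          (Submodule.finrank_map_subtype_eq _ _)).trans (p.2.2.2 _)
      · exact ((congrArg (fun X : Submodule F V => Module.finrank F X) (dif_neg h)).trans
          p.1.2).trans ((Finset.mem_insert.1 hu).resolve_right h).symm⟩
  left_inv f := by
    apply Subtype.ext
    funext u
    obtain ⟨u, hu⟩ := u
    by_cases h : u ∈ U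
    · simp only [h, dif_pos]
      rw [Submodule.map_comap_subtype, inf_eq_right.2 (f.2.1 (Subtype.mk_le_mk.2 (hU u h).le))]
    · simp only [h, dif_neg, not_false_eq_true]
      exact congrArg f.1 (Subtype.ext ((Finset.mem_insert.1 hu).resolve_right h).symm)
  right_inv p := by
    have hm : m ∉ U := fun h => (hU m h).false
    have h1 : (if h : m ∈ U then (p.2.1 ⟨m, h⟩).map p.1.1.subtype else p.1.1) = p.1.1 :=
      dif_neg hm
    refine sigma_flag_ext h1 fun u => ?_
    have h2 : (if h : (u : ℕ) ∈ U then (p.2.1 ⟨u, h⟩).map p.1.1.subtype else p.1.1) =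
      (p.2.1 u).map p.1.1.subtype := dif_pos u.2
    dsimp only
    rw [Submodule.map_comap_subtype, h2, h1]
    exact inf_eq_right.2 (Submodule.map_subtype_le _ _)

lemma card_flagOfDims_insert [Fintype F] [Finite V] {m : ℕ} {U : Finset ℕ} (hU : ∀ u ∈ U, u < m)
    (hm : m ≤ Module.finrank F V) {N : ℕ}
    (hN : ∀ W : Submodule F V, Module.finrank F W = m → Nat.card (FlagOfDims F W U) = N) :
    Nat.card (FlagOfDims F V (insert m U)) =
      gaussBinom (Fintype.card F) (Module.finrank F V) m * N := by
  have hfd : FiniteDimensional F V := Module.Finite.of_finite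
  have : Fintype {W : Submodule F V // Module.finrank F W = m} := Fintype.ofFinite _
  rw [Nat.card_congr (flagInsertEquiv hU), Nat.card_sigma,
    Finset.sum_congr rfl fun W _ => hN W.1 W.2, Finset.sum_const, Finset.card_univ,
    ← Nat.card_eq_fintype_card, card_submodule_finrank_eq hm, smul_eq_mul]

end Subspaces

/-! ### Permutations with prescribed possible descents -/

lemma strictMono_fin_of_lt_succ {α : Type*} [Preorder α] {k : ℕ} {f : Fin k → α}
    (h : ∀ i (hi : i + 1 < k), f ⟨i, by omega⟩ < f ⟨i + 1, hi⟩) : StrictMono f := by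
  cases k with
  | zero => exact fun i => i.elim0
  | succ k => exact Fin.strictMono_iff_lt_succ.2 fun i => h i (by omega)

/-- Every descent of `σ` lies in `U` (1-indexed). -/
def DescentsIn {n : ℕ} (U : Finset ℕ) (σ : Equiv.Perm (Fin n)) : Prop :=
  ∀ i (hi : i + 1 < n), i + 1 ∉ U → σ ⟨i, by omega⟩ < σ ⟨i + 1, hi⟩

/-- The generating function by inversions of the permutations with all descents in `U`. -/
noncomputable def descentGenFun (q n : ℕ) (U : Finset ℕ) : ℕ :=
  ∑ σ : Equiv.Perm (Fin n) with DescentsIn U σ, q ^ permInv σ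

lemma permInv_eq_sum {n : ℕ} (σ : Equiv.Perm (Fin n)) :
    permInv σ = ∑ i, ∑ j, if i < j ∧ σ j < σ i then 1 else 0 := by
  rw [permInv, ← Fintype.sum_prod_type' (f := fun i j => if i < j ∧ σ j < σ i then 1 else 0),
    Set.ncard_eq_toFinset_card', Finset.card_eq_sum_ones, Set.toFinset_ofPred, Finset.sum_filter]

lemma permInv_one (n : ℕ) : permInv (1 : Equiv.Perm (Fin n)) = 0 := by
  rw [permInv_eq_sum]
  refine Finset.sum_eq_zero fun i _ => Finset.sum_eq_zero fun j _ => if_neg ?_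
  rintro ⟨h1, h2⟩
  exact lt_asymm h1 h2

lemma eq_one_of_strictMono {n : ℕ} {σ : Equiv.Perm (Fin n)} (h : StrictMono σ) : σ = 1 := by
  have h1 := Finset.orderEmbOfFin_unique (s := Finset.univ) (Finset.card_fin n)
    (fun x => Finset.mem_univ (σ x)) h
  have h2 := Finset.orderEmbOfFin_unique (s := Finset.univ) (Finset.card_fin n)
    (fun x => Finset.mem_univ x) strictMono_id
  exact Equiv.ext fun x => congrFun (h1.trans h2.symm) x

lemma descentGenFun_empty (q n : ℕ) : descentGenFun q n ∅ = 1 := by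
  have : (Finset.univ.filter fun σ : Equiv.Perm (Fin n) => DescentsIn ∅ σ) = {1} := by
    ext σ
    simp only [Finset.mem_filter, Finset.mem_univ, true_and, Finset.mem_singleton]
    constructor
    · exact fun h => eq_one_of_strictMono
        (strictMono_fin_of_lt_succ fun i hi => h i hi (Finset.notMem_empty _))
    · rintro rfl i hi -
      exact Fin.mk_lt_mk.2 i.lt_succ_self
  rw [descentGenFun, this, Finset.sum_singleton, permInv_one, pow_zero]

section Shuffle

variable {m k : ℕ}

lemma card_compl_of_card_eq {S : Finset (Fin (m + k))} (hS : S.card = m) : Sᶜ.card = k := by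
  rw [Finset.card_compl, Fintype.card_fin, hS, Nat.add_sub_cancel_left]

/-- The permutation whose first `m` values are the elements of `S`, in the relative order given
by `τ`, and whose remaining values are the elements of `Sᶜ` in increasing order. -/
def shufflePerm (S : Finset (Fin (m + k))) (hS : S.card = m) (τ : Equiv.Perm (Fin m)) :
    Equiv.Perm (Fin (m + k)) :=
  finSumFinEquiv.symm.trans ((Equiv.sumCongr τ (Equiv.refl _)).trans
    (finSumEquivOfFinset hS (card_compl_of_card_eq hS)))

variable {S : Finset (Fin (m + k))} (hS : S.card = m) (τ : Equiv.Perm (Fin m))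

lemma shufflePerm_castAdd (i : Fin m) :
    shufflePerm S hS τ (Fin.castAdd k i) = S.orderEmbOfFin hS (τ i) := by
  simp [shufflePerm]

lemma shufflePerm_natAdd (j : Fin k) :
    shufflePerm S hS τ (Fin.natAdd m j) = Sᶜ.orderEmbOfFin (card_compl_of_card_eq hS) j := by
  simp [shufflePerm]

lemma sum_orderEmbOfFin {α M : Type*} [LinearOrder α] [AddCommMonoid M] {s : Finset α} {r : ℕ}
    (h : s.card = r) (f : α → M) : ∑ i, f (s.orderEmbOfFin h i) = ∑ x ∈ s, f x := by
  conv_rhs => rw [← Finset.map_orderEmbOfFin_univ s h, Finset.sum_map]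
  rfl

lemma subsetInv_map_val (S : Finset (Fin (m + k))) :
    subsetInv (S.map Fin.valEmbedding) = ∑ x ∈ S, ∑ y ∈ Sᶜ, if y < x then 1 else 0 := by
  rw [subsetInv, Finset.sum_map]
  refine Finset.sum_congr rfl fun x _ => ?_
  rw [← Finset.sum_filter, ← Finset.card_eq_sum_ones,
    ← Finset.card_map (Fin.valEmbedding (n := m + k))]
  congr 1
  ext y
  simp only [Finset.mem_sdiff, Finset.mem_range, Finset.mem_map, Finset.mem_filter,
    Finset.mem_compl, Fin.valEmbedding_apply]
  constructor
  · rintro ⟨h1, h2⟩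
    exact ⟨⟨y, h1.trans x.2⟩, ⟨fun h => h2 ⟨_, h, rfl⟩, h1⟩, rfl⟩
  · rintro ⟨z, ⟨h1, h2⟩, rfl⟩
    refine ⟨h2, ?_⟩
    rintro ⟨w, hw, hwz⟩
    exact h1 (Fin.ext hwz ▸ hw)

lemma permInv_shufflePerm :
    permInv (shufflePerm S hS τ) = subsetInv (S.map Fin.valEmbedding) + permInv τ := by
  have h1 : ∀ i j : Fin m, (Fin.castAdd k i < Fin.castAdd k j ∧
      S.orderEmbOfFin hS (τ j) < S.orderEmbOfFin hS (τ i)) ↔ (i < j ∧ τ j < τ i) := fun i j => by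
    rw [OrderEmbedding.lt_iff_lt]; rfl
  have h2 : ∀ (i : Fin m) (j : Fin k), Fin.castAdd k i < Fin.natAdd m j := fun i j => by
    rw [Fin.lt_def]; simp only [Fin.val_castAdd, Fin.val_natAdd]; omega
  have h3 : ∀ (i : Fin k) (j : Fin k),
      ¬ (Fin.natAdd m i < Fin.natAdd m j ∧
        Sᶜ.orderEmbOfFin (card_compl_of_card_eq hS) j <
          Sᶜ.orderEmbOfFin (card_compl_of_card_eq hS) i) := by
    rintro i j ⟨h, h'⟩
    rw [OrderEmbedding.lt_iff_lt] at h'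
    rw [Fin.lt_def] at h h'
    simp only [Fin.val_natAdd] at h
    omega
  rw [permInv_eq_sum, Fin.sum_univ_add]
  simp only [Fin.sum_univ_add, shufflePerm_castAdd, shufflePerm_natAdd, h1, h2, h3,
    (h2 _ _).not_gt, true_and, false_and, if_false, Finset.sum_const_zero, add_zero,
    Finset.sum_add_distrib]
  rw [permInv_eq_sum τ, add_comm, subsetInv_map_val]
  congr 1
  rw [Equiv.sum_comp τ fun i => ∑ j, if Sᶜ.orderEmbOfFin (card_compl_of_card_eq hS) j <
    S.orderEmbOfFin hS i then 1 else 0,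
    sum_orderEmbOfFin hS fun x => ∑ j, if Sᶜ.orderEmbOfFin (card_compl_of_card_eq hS) j < x
      then 1 else 0]
  exact Finset.sum_congr rfl fun x _ =>
    sum_orderEmbOfFin (card_compl_of_card_eq hS) fun y => if y < x then 1 else 0

lemma descentsIn_shufflePerm {U : Finset ℕ} :
    DescentsIn (insert m U) (shufflePerm S hS τ) ↔ DescentsIn U τ := by
  constructor
  · intro h i hi hiU
    have := h i (by omega) (by simp [hiU]; omega)
    rw [← OrderEmbedding.lt_iff_lt (S.orderEmbOfFin hS), ← shufflePerm_castAdd,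
      ← shufflePerm_castAdd]
    exact this
  · intro h i hi hiU
    rw [Finset.mem_insert, not_or] at hiU
    rcases lt_or_gt_of_ne hiU.1 with him | him
    · have := h i him hiU.2
      rw [← OrderEmbedding.lt_iff_lt (S.orderEmbOfFin hS), ← shufflePerm_castAdd,
        ← shufflePerm_castAdd] at this
      exact this
    · obtain ⟨j, rfl⟩ := Nat.exists_eq_add_of_le (Nat.lt_succ_iff.1 him)
      have := (OrderEmbedding.lt_iff_lt
        (Sᶜ.orderEmbOfFin (card_compl_of_card_eq hS))).2
          (show (⟨j, by omega⟩ : Fin k) < ⟨j + 1, by omega⟩ from Fin.mk_lt_mk.2 j.lt_succ_self)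
      rw [← shufflePerm_natAdd hS τ, ← shufflePerm_natAdd hS τ] at this
      exact this

lemma image_shufflePerm :
    (Finset.univ.image fun i => shufflePerm S hS τ (Fin.castAdd k i)) = S := by
  apply Finset.eq_of_subset_of_card_le
  · intro x hx
    obtain ⟨i, -, rfl⟩ := Finset.mem_image.1 hx
    rw [shufflePerm_castAdd]
    exact Finset.orderEmbOfFin_mem _ _ _
  · rw [Finset.card_image_of_injective, Finset.card_univ, Fintype.card_fin, hS]
    exact (Equiv.injective _).comp (Fin.castAdd_injective m k)

lemma exists_shufflePerm_eq {U : Finset ℕ} (hU : ∀ u ∈ U, u < m) {σ : Equiv.Perm (Fin (m + k))}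
    (hσ : DescentsIn (insert m U) σ) :
    ∃ (S : Finset (Fin (m + k))) (hS : S.card = m) (τ : Equiv.Perm (Fin m)),
      shufflePerm S hS τ = σ := by
  have hinj : Function.Injective fun i => σ (Fin.castAdd k i) :=
    σ.injective.comp (Fin.castAdd_injective m k)
  set S : Finset (Fin (m + k)) := Finset.univ.image fun i => σ (Fin.castAdd k i) with hSdef
  have hS : S.card = m := by
    rw [Finset.card_image_of_injective _ hinj, Finset.card_univ, Fintype.card_fin]
  have hmem : ∀ i, σ (Fin.castAdd k i) ∈ S := fun i =>
    Finset.mem_image_of_mem _ (Finset.mem_univ i)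
  let τ₀ : Fin m → Fin m := fun i => (S.orderIsoOfFin hS).symm ⟨_, hmem i⟩
  have hτ₀ : ∀ i, S.orderEmbOfFin hS (τ₀ i) = σ (Fin.castAdd k i) := fun i => by
    rw [← Finset.coe_orderIsoOfFin_apply, OrderIso.apply_symm_apply]
  have hτinj : Function.Injective τ₀ := fun i j hij => by
    apply hinj
    change σ _ = σ _
    rw [← hτ₀, ← hτ₀, hij]
  refine ⟨S, hS, Equiv.ofBijective τ₀ (Finite.injective_iff_bijective.1 hτinj), ?_⟩
  have hmono : StrictMono fun j : Fin k => σ (Fin.natAdd m j) :=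
    strictMono_fin_of_lt_succ fun j hj => hσ (m + j) (by omega) fun h => by
      rcases Finset.mem_insert.1 h with h | h
      · omega
      · have := hU _ h
        omega
  have hnat := Finset.orderEmbOfFin_unique (card_compl_of_card_eq hS)
    (f := fun j : Fin k => σ (Fin.natAdd m j)) (fun j => by
      rw [Finset.mem_compl, hSdef, Finset.mem_image]
      rintro ⟨i, -, hi⟩
      have := congrArg Fin.val (σ.injective hi)
      simp only [Fin.val_castAdd, Fin.val_natAdd] at this
      omega) hmono
  ext1 x
  refine Fin.addCases (fun i => ?_) (fun j => ?_) x
  · rw [shufflePerm_castAdd]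
    exact hτ₀ i
  · rw [shufflePerm_natAdd]
    exact (congrFun hnat j).symm

lemma shufflePerm_injective {S' : Finset (Fin (m + k))} (hS' : S'.card = m)
    {τ' : Equiv.Perm (Fin m)} (h : shufflePerm S hS τ = shufflePerm S' hS' τ') :
    S = S' ∧ τ = τ' := by
  obtain rfl : S = S' := by rw [← image_shufflePerm hS τ, h, image_shufflePerm]
  refine ⟨rfl, Equiv.ext fun i => (S.orderEmbOfFin hS).injective ?_⟩
  rw [← shufflePerm_castAdd, ← shufflePerm_castAdd, h]

lemma gaussBinom_eq_sum_fin (q n m : ℕ) :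
    gaussBinom q n m = ∑ S ∈ (Finset.univ : Finset (Fin n)).powersetCard m,
      q ^ subsetInv (S.map Fin.valEmbedding) := by
  have : Finset.range n = Finset.univ.map (Fin.valEmbedding (n := n)) := by
    rw [Fin.map_valEmbedding_univ]; ext; simp
  rw [gaussBinom, this, Finset.powersetCard_map, Finset.sum_map]
  rfl

lemma descentGenFun_insert (q : ℕ) {U : Finset ℕ} (hU : ∀ u ∈ U, u < m) :
    descentGenFun q (m + k) (insert m U) = gaussBinom q (m + k) m * descentGenFun q m U := by
  rw [gaussBinom_eq_sum_fin, descentGenFun, descentGenFun, Finset.sum_mul_sum,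
    ← Finset.sum_product']
  symm
  refine Finset.sum_bij (fun p hp => shufflePerm p.1
    (Finset.mem_powersetCard.1 (Finset.mem_product.1 hp).1).2 p.2) ?_ ?_ ?_ ?_
  · intro p hp
    rw [Finset.mem_filter, descentsIn_shufflePerm]
    exact ⟨Finset.mem_univ _, (Finset.mem_filter.1 (Finset.mem_product.1 hp).2).2⟩
  · intro p hp p' hp' h
    obtain ⟨h1, h2⟩ := shufflePerm_injective _ _ _ h
    exact Prod.ext h1 h2
  · intro σ hσ
    have hσ' := (Finset.mem_filter.1 hσ).2
    obtain ⟨S, hS, τ, rfl⟩ := exists_shufflePerm_eq hU hσ'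
    refine ⟨(S, τ), Finset.mem_product.2 ⟨Finset.mem_powersetCard.2 ⟨Finset.subset_univ _, hS⟩,
      Finset.mem_filter.2 ⟨Finset.mem_univ _, (descentsIn_shufflePerm hS τ).1 hσ'⟩⟩, rfl⟩
  · intro p hp
    rw [permInv_shufflePerm, pow_add]

end Shuffle

lemma card_flagOfDims {F : Type*} [Field F] [Fintype F] (U : Finset ℕ) :
    ∀ {V : Type*} [AddCommGroup V] [Module F V] [Finite V],
      (∀ u ∈ U, u < Module.finrank F V) →
      Nat.card (FlagOfDims F V U) =
        descentGenFun (Fintype.card F) (Module.finrank F V) U := by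
  induction U using Finset.induction_on_max with
  | empty =>
    intro V _ _ _ _
    rw [descentGenFun_empty, Nat.card_eq_one_iff_unique]
    refine ⟨⟨fun f g => Subtype.ext (funext fun u => ?_)⟩, ⟨⟨fun _ => ⊥, fun u => ?_, fun u => ?_⟩⟩⟩
    all_goals exact absurd u.2 (Finset.notMem_empty _)
  | insert m U hU ih =>
    intro V _ _ _ hV
    have hm := hV m (Finset.mem_insert_self m U)
    obtain ⟨k, hk⟩ := Nat.exists_eq_add_of_le hm.le
    rw [card_flagOfDims_insert hU hm.le
      (N := descentGenFun (Fintype.card F) m U), hk, descentGenFun_insert _ hU]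
    intro W hW
    rw [ih (V := W) (by rwa [hW]), hW]

/-! ### Maximal chains of rank-selected subposets -/

section RankSelection

/-- The extension of a family indexed by `U` by `b` at `0` and by `tp` elsewhere. -/
noncomputable def extendFamily {α : Type*} {U : Finset ℕ} (b tp : α) (f : U → α) (r : ℕ) : α :=
  if h : r ∈ U then f ⟨r, h⟩ else if r = 0 then b else tp

lemma extendFamily_of_mem {α : Type*} {U : Finset ℕ} (b tp : α) (f : U → α) {r : ℕ} (hr : r ∈ U) :
    extendFamily b tp f r = f ⟨r, hr⟩ := dif_pos hr

variable {α : Type*} [PartialOrder α] {rk : α → ℕ} {b tp : α} {n : ℕ} {U : Finset ℕ}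

lemma card_insert_zero_insert (hn : 1 ≤ n) (hU : ∀ u ∈ U, 1 ≤ u ∧ u < n) :
    (insert 0 (insert n U)).card = U.card + 1 + 1 := by
  rw [Finset.card_insert_of_notMem, Finset.card_insert_of_notMem]
  · exact fun h => (hU n h).2.false
  · intro h
    rcases Finset.mem_insert.1 h with h | h
    · omega
    · exact absurd (hU 0 h).1 (by omega)

/-- `rk` is a strictly monotone rank function, and `b` and `tp` are the bottom and top elements,
of ranks `0` and `n`. -/
structure IsBoundedRank (rk : α → ℕ) (b tp : α) (n : ℕ) : Prop where
  strictMono : StrictMono rk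
  rk_bot : rk b = 0
  rk_top : rk tp = n
  bot_le : ∀ x, b ≤ x
  le_top : ∀ x, x ≤ tp

lemma IsBoundedRank.eq_bot (h : IsBoundedRank rk b tp n) {x : α} (hx : rk x = 0) : x = b := by
  by_contra hne
  have := h.strictMono (lt_of_le_of_ne (h.bot_le x) (Ne.symm hne))
  omega

lemma IsBoundedRank.eq_top (h : IsBoundedRank rk b tp n) {x : α} (hx : rk x = n) : x = tp := by
  by_contra hne
  have := h.strictMono (lt_of_le_of_ne (h.le_top x) hne)
  have := h.rk_top
  omega

/-- The increasing enumeration of the ranks `U ∪ {0, n}`. -/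
noncomputable def rankEnum (hn : 1 ≤ n) (hU : ∀ u ∈ U, 1 ≤ u ∧ u < n) :
    Fin (U.card + 1 + 1) ↪o ℕ :=
  (insert 0 (insert n U)).orderEmbOfFin (card_insert_zero_insert hn hU)

variable (hn : 1 ≤ n) (hU : ∀ u ∈ U, 1 ≤ u ∧ u < n)

lemma range_rankEnum : Set.range (rankEnum hn hU) = ↑(insert 0 (insert n U)) :=
  Finset.range_orderEmbOfFin _ _

lemma rankEnum_mem (j) : rankEnum hn hU j ∈ insert 0 (insert n U) :=
  Finset.orderEmbOfFin_mem _ _ _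

lemma le_of_mem_insert {u : ℕ} (hU : ∀ u ∈ U, 1 ≤ u ∧ u < n) (h : u ∈ insert 0 (insert n U)) :
    u ≤ n := by
  rcases Finset.mem_insert.1 h with rfl | h
  · omega
  rcases Finset.mem_insert.1 h with rfl | h
  · omega
  · exact (hU u h).2.le

lemma rankEnum_zero : rankEnum hn hU 0 = 0 := by
  obtain ⟨j, hj⟩ : 0 ∈ Set.range (rankEnum hn hU) := by rw [range_rankEnum]; simp
  exact Nat.le_zero.1 (((rankEnum hn hU).monotone (Fin.zero_le j)).trans_eq hj)

lemma rankEnum_last : rankEnum hn hU (Fin.last _) = n := by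
  obtain ⟨j, hj⟩ : n ∈ Set.range (rankEnum hn hU) := by rw [range_rankEnum]; simp
  exact le_antisymm (le_of_mem_insert hU (rankEnum_mem hn hU _))
    (hj.symm.trans_le ((rankEnum hn hU).monotone (Fin.le_last j)))

lemma IsBoundedRank.rk_mem (h : IsBoundedRank rk b tp n) (x : RankSel rk b tp U) :
    rk x.1 ∈ insert 0 (insert n U) := by
  obtain ⟨x, hx | rfl | rfl⟩ := x
  · simp [hx]
  · simp [h.rk_bot]
  · simp [h.rk_top]

lemma IsBoundedRank.mem_maxChains_iff (h : IsBoundedRank rk b tp n)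
    (c : Fin (U.card + 1 + 1) → RankSel rk b tp U) :
    c ∈ maxChains (⟨b, Or.inr (Or.inl rfl)⟩ : RankSel rk b tp U) ⟨tp, Or.inr (Or.inr rfl)⟩
        (U.card + 1) ↔
      StrictMono c ∧ ∀ j, rk (c j).1 = rankEnum hn hU j := by
  constructor
  · rintro ⟨-, -, hc⟩
    have hmono : StrictMono c := Fin.strictMono_iff_lt_succ.2 fun j => (hc j).lt
    exact ⟨hmono, fun j => congrFun (Finset.orderEmbOfFin_unique
      (card_insert_zero_insert hn hU) (fun j => h.rk_mem (c j))
      fun i j hij => h.strictMono (hmono hij)) j⟩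
  · rintro ⟨hmono, hc⟩
    refine ⟨Subtype.ext (h.eq_bot ?_), Subtype.ext (h.eq_top ?_), fun j =>
      ⟨hmono j.castSucc_lt_succ, fun z hz hz' => ?_⟩⟩
    · rw [hc, rankEnum_zero]
    · rw [hc, rankEnum_last]
    · have hz1 : rk (c j.castSucc).1 < rk z.1 := h.strictMono hz
      have hz2 : rk z.1 < rk (c j.succ).1 := h.strictMono hz'
      obtain ⟨i, hi⟩ : rk z.1 ∈ Set.range (rankEnum hn hU) := by
        rw [range_rankEnum]
        exact h.rk_mem z
      rw [hc, ← hi, OrderEmbedding.lt_iff_lt] at hz1 hz2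
      rw [Fin.lt_def] at hz1 hz2
      simp only [Fin.val_castSucc, Fin.val_succ] at hz1 hz2
      omega

lemma IsBoundedRank.rk_extendFamily (h : IsBoundedRank rk b tp n) {f : U → α}
    (hf : ∀ u, rk (f u) = u) {r : ℕ} (hr : r ∈ insert 0 (insert n U)) :
    rk (extendFamily b tp f r) = r := by
  by_cases hrU : r ∈ U
  · rw [extendFamily_of_mem _ _ _ hrU, hf]
  · rw [extendFamily, dif_neg hrU]
    split_ifs with h0
    · rw [h.rk_bot, h0]
    · have hr' := (Finset.mem_insert.1 hr).resolve_left h0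
      rw [h.rk_top, (Finset.mem_insert.1 hr').resolve_right hrU]

lemma IsBoundedRank.extendFamily_lt (h : IsBoundedRank rk b tp n)
    (hU : ∀ u ∈ U, 1 ≤ u ∧ u < n) {f : U → α}
    (hmono : Monotone f) (hf : ∀ u, rk (f u) = u) {r s : ℕ} (hr : r ∈ insert 0 (insert n U))
    (hs : s ∈ insert 0 (insert n U)) (hrs : r < s) :
    extendFamily b tp f r < extendFamily b tp f s := by
  refine lt_of_le_of_ne ?_ fun heq => ?_
  · by_cases hsU : s ∈ U
    · by_cases hrU : r ∈ U
      · rw [extendFamily_of_mem _ _ _ hrU, extendFamily_of_mem _ _ _ hsU]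
        exact hmono hrs.le
      · have hr0 : r = 0 := by
          have := (hU s hsU).2
          rcases Finset.mem_insert.1 hr with hr | hr
          · exact hr
          · rcases Finset.mem_insert.1 hr with hr | hr
            · omega
            · exact absurd hr hrU
        rw [extendFamily, dif_neg hrU, if_pos hr0]
        exact h.bot_le _
    · rw [extendFamily.eq_def b tp f s, dif_neg hsU, if_neg (by omega)]
      exact h.le_top _
  · have := congrArg rk heq
    rw [h.rk_extendFamily hf hr, h.rk_extendFamily hf hs] at this
    omega

lemma IsBoundedRank.alphaT_eq (h : IsBoundedRank rk b tp n) (hn : 1 ≤ n)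
    (hU : ∀ u ∈ U, 1 ≤ u ∧ u < n) :
    alphaT rk b tp U = Nat.card {f : U → α // Monotone f ∧ ∀ u, rk (f u) = u} := by
  have hidx : ∀ u : U, ∃ j, rankEnum hn hU j = u := fun u => by
    have : (u : ℕ) ∈ Set.range (rankEnum hn hU) := by
      rw [range_rankEnum]
      simp
    exact this
  choose idx hidx using hidx
  have hidx_le : ∀ u v : U, u ≤ v → idx u ≤ idx v := fun u v huv => by
    rw [← (rankEnum hn hU).le_iff_le, hidx, hidx]
    exact huv
  rw [alphaT, ← Nat.card_coe_set_eq]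
  refine Nat.card_congr (Equiv.ofBijective (fun c => ⟨fun u => (c.1 (idx u)).1, ?_, ?_⟩) ⟨?_, ?_⟩)
  · exact fun u v huv =>
      ((h.mem_maxChains_iff hn hU c.1).1 c.2).1.monotone (hidx_le u v huv)
  · intro u
    rw [((h.mem_maxChains_iff hn hU c.1).1 c.2).2, hidx]
  · intro c c' hcc'
    have hc := ((h.mem_maxChains_iff hn hU c.1).1 c.2).2
    have hc' := ((h.mem_maxChains_iff hn hU c'.1).1 c'.2).2
    refine Subtype.ext (funext fun j => Subtype.ext ?_)
    rcases Finset.mem_insert.1 (rankEnum_mem hn hU j) with hj | hj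
    · rw [h.eq_bot ((hc j).trans hj), h.eq_bot ((hc' j).trans hj)]
    · rcases Finset.mem_insert.1 hj with hj | hj
      · rw [h.eq_top ((hc j).trans hj), h.eq_top ((hc' j).trans hj)]
      · have hji : idx ⟨_, hj⟩ = j := (rankEnum hn hU).injective (hidx _)
        have := congrFun (congrArg Subtype.val hcc') ⟨_, hj⟩
        simpa only [hji] using this
  · rintro ⟨f, hmono, hf⟩
    have hmem : ∀ j, rk (extendFamily b tp f (rankEnum hn hU j)) ∈ U ∨
        extendFamily b tp f (rankEnum hn hU j) = b ∨
        extendFamily b tp f (rankEnum hn hU j) = tp := fun j => by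
      by_cases hj : rankEnum hn hU j ∈ U
      · left
        rwa [h.rk_extendFamily hf (rankEnum_mem hn hU j)]
      · right
        rw [extendFamily, dif_neg hj]
        split_ifs <;> simp
    refine ⟨⟨fun j => ⟨extendFamily b tp f (rankEnum hn hU j), hmem j⟩,
      (h.mem_maxChains_iff hn hU _).2 ⟨fun i j hij => ?_, fun j => ?_⟩⟩, ?_⟩
    · exact h.extendFamily_lt hU hmono hf (rankEnum_mem hn hU i) (rankEnum_mem hn hU j)
        ((rankEnum hn hU).strictMono hij)
    · exact h.rk_extendFamily hf (rankEnum_mem hn hU j)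
    · refine Subtype.ext (funext fun u => ?_)
      have : extendFamily b tp f u = f u := extendFamily_of_mem b tp f u.2
      simpa only [hidx] using this

end RankSelection

/-! ### Segre powers of the subspace lattice -/

section Segre

variable {F V : Type*} [Field F] [AddCommGroup V] [Module F V]

lemma isBoundedRank_segrePower [FiniteDimensional F V] {t : ℕ} (ht : 1 ≤ t) :
    IsBoundedRank
      (fun X : SegrePower (fun W : Submodule F V => Module.finrank F W) t =>
        Module.finrank F (X.1 ⟨0, ht⟩))
      ⟨fun _ => (⊥ : Submodule F V), fun _ _ => rfl⟩
      ⟨fun _ => (⊤ : Submodule F V), fun _ _ => rfl⟩ (Module.finrank F V) where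
  strictMono X Y hXY := by
    obtain ⟨-, i, hi⟩ := Pi.lt_def.1 (show X.1 < Y.1 from hXY)
    have := Submodule.finrank_lt_finrank_of_lt hi
    exact (X.2 ⟨0, ht⟩ i).trans_lt (this.trans_eq (Y.2 i ⟨0, ht⟩))
  rk_bot := finrank_bot F V
  rk_top := finrank_top F V
  bot_le _ _ := bot_le
  le_top _ _ := le_top

/-- A rank-selected chain in the Segre power amounts to a tuple of flags. -/
def segreFlagEquiv {t : ℕ} (ht : 1 ≤ t) (U : Finset ℕ) :
    {f : U → SegrePower (fun W : Submodule F V => Module.finrank F W) t //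
      Monotone f ∧ ∀ u, Module.finrank F ((f u).1 ⟨0, ht⟩) = u} ≃
      (Fin t → FlagOfDims F V U) where
  toFun f i := ⟨fun u => (f.1 u).1 i, fun _ _ huv => f.2.1 huv i, fun u =>
    ((f.1 u).2 i ⟨0, ht⟩).trans (f.2.2 u)⟩
  invFun g := ⟨fun u => ⟨fun i => (g i).1 u, fun i j => ((g i).2.2 u).trans ((g j).2.2 u).symm⟩,
    fun _ _ huv i => (g i).2.1 huv, fun u => (g _).2.2 u⟩
  left_inv _ := rfl
  right_inv _ := rfl

lemma alphaT_segrePower [Fintype F] [Finite V] {t : ℕ} (ht : 1 ≤ t)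
    (hn : 1 ≤ Module.finrank F V) {U : Finset ℕ}
    (hU : ∀ u ∈ U, 1 ≤ u ∧ u < Module.finrank F V) :
    alphaT
      (fun X : SegrePower (fun W : Submodule F V => Module.finrank F W) t =>
        Module.finrank F (X.1 ⟨0, ht⟩))
      ⟨fun _ => (⊥ : Submodule F V), fun _ _ => rfl⟩
      ⟨fun _ => (⊤ : Submodule F V), fun _ _ => rfl⟩ U =
      descentGenFun (Fintype.card F) (Module.finrank F V) U ^ t := by
  have hfd : FiniteDimensional F V := Module.Finite.of_finite
  rw [(isBoundedRank_segrePower ht).alphaT_eq hn hU, Nat.card_congr (segreFlagEquiv ht U),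
    Nat.card_fun, Nat.card_fin,
    card_flagOfDims U fun u hu => (hU u hu).2]

end Segre

/-! ### Inclusion–exclusion -/

lemma sum_powerset_neg_one_pow_of_subset (D J : Finset ℕ) :
    ∑ U ∈ J.powerset, (-1 : ℤ) ^ (J.card - U.card) * (if D ⊆ U then 1 else 0) =
      if D = J then 1 else 0 := by
  by_cases hDJ : D ⊆ J
  · have h := Finset.prod_add (fun _ => (1 : ℤ)) (fun i => if i ∈ D then 0 else -1) J
    have hL : ∏ i ∈ J, ((1 : ℤ) + if i ∈ D then 0 else -1) = if D = J then 1 else 0 := by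
      split_ifs with hD
      · subst hD
        exact Finset.prod_eq_one fun i hi => by simp [hi]
      · obtain ⟨i, hi, hiD⟩ := Finset.exists_of_ssubset (lt_of_le_of_ne hDJ hD)
        exact Finset.prod_eq_zero hi (by simp [hiD])
    rw [← hL, h]
    refine Finset.sum_congr rfl fun U hU => ?_
    rw [Finset.prod_const_one, one_mul]
    split_ifs with hD
    · rw [mul_one, ← Finset.card_sdiff_of_subset (Finset.mem_powerset.1 hU), ← Finset.prod_const]
      exact Finset.prod_congr rfl fun i hi =>
        (if_neg fun h => (Finset.mem_sdiff.1 hi).2 (hD h)).symm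
    · obtain ⟨i, hiD, hiU⟩ := Finset.not_subset.1 hD
      rw [mul_zero]
      symm
      exact Finset.prod_eq_zero (Finset.mem_sdiff.2 ⟨hDJ hiD, hiU⟩) (if_pos hiD)
  · rw [if_neg fun h => hDJ h.subset]
    refine Finset.sum_eq_zero fun U hU => ?_
    rw [if_neg fun h => hDJ (h.trans (Finset.mem_powerset.1 hU)), mul_zero]

/-- The positions in `[n - 1]` (1-indexed) at which some `σ j` has a descent. -/
noncomputable def jointDescents {n t : ℕ} (σ : Fin t → Equiv.Perm (Fin n)) : Finset ℕ :=
  (Finset.Ico 1 n).filter fun i => ∃ j, i ∉ permAsc (σ j)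

lemma forall_descentsIn_iff {n t : ℕ} (σ : Fin t → Equiv.Perm (Fin n)) (U : Finset ℕ) :
    (∀ j, DescentsIn U (σ j)) ↔ jointDescents σ ⊆ U := by
  constructor
  · intro h i hi
    obtain ⟨hi, j, hj⟩ := Finset.mem_filter.1 hi
    obtain ⟨h1, h2⟩ := Finset.mem_Ico.1 hi
    by_contra hiU
    obtain ⟨i, rfl⟩ := Nat.exists_eq_add_of_le' h1
    exact hj ⟨⟨h1, h2⟩, h j i h2 hiU⟩
  · intro h j i hi hiU
    by_contra hlt
    refine hiU (h (Finset.mem_filter.2 ⟨Finset.mem_Ico.2 ⟨by omega, hi⟩, j, ?_⟩))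
    rintro ⟨_, h'⟩
    exact hlt h'

lemma iInter_permAsc_eq_iff {n t : ℕ} (ht : 1 ≤ t) (σ : Fin t → Equiv.Perm (Fin n))
    {J : Finset ℕ} (hJ : ∀ i ∈ J, 1 ≤ i ∧ i < n) :
    (⋂ j, permAsc (σ j)) = {i : ℕ | 1 ≤ i ∧ i < n} \ ↑J ↔ jointDescents σ = J := by
  have hmem : ∀ i, i ∈ jointDescents σ ↔ (1 ≤ i ∧ i < n) ∧ i ∉ ⋂ j, permAsc (σ j) := fun i => by
    rw [jointDescents, Finset.mem_filter, Finset.mem_Ico, Set.mem_iInter, not_forall]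
  have hsub : ∀ i ∈ ⋂ j, permAsc (σ j), 1 ≤ i ∧ i < n := fun i hi =>
    (Set.mem_iInter.1 hi ⟨0, ht⟩).1
  rw [Set.ext_iff, Finset.ext_iff]
  refine forall_congr' fun i => ?_
  have h1 := hsub i
  have h2 := hJ i
  rw [hmem, Set.mem_sdiff, Set.mem_ofPred_eq, Finset.mem_coe]
  tauto

lemma descentGenFun_pow (q n t : ℕ) (U : Finset ℕ) :
    ((descentGenFun q n U ^ t : ℕ) : ℤ) = ∑ σ : Fin t → Equiv.Perm (Fin n),
      (∏ j, (q : ℤ) ^ permInv (σ j)) * (if jointDescents σ ⊆ U then 1 else 0) := by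
  rw [descentGenFun, Finset.sum_filter, Fintype.sum_pow, Nat.cast_sum]
  refine Finset.sum_congr rfl fun σ _ => ?_
  simp only [← forall_descentsIn_iff]
  split_ifs with h
  · simp [h]
  · obtain ⟨j, hj⟩ := not_forall.1 h
    rw [mul_zero, Finset.prod_eq_zero (Finset.mem_univ j) (if_neg hj), Nat.cast_zero]

/-- for `J ⊆ [n-1]`, the rank-selected invariant of the `t`-fold Segre power of
the subspace lattice `B_n(q)` satisfies
`β̃_{B_n⁽ᵗ⁾(q)}(J) = Σ Π_{i=1}^t q^{inv(σ^i)}`, the sum being over all `t`-tuples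
`(σ^1, …, σ^t)` of permutations in `S_n` with `Asc(σ^1) ∩ ⋯ ∩ Asc(σ^t) = [n-1] \ J`. -/
theorem stmt18 {F : Type*} [Field F] [Fintype F] (q : ℕ) (hq : Fintype.card F = q)
    (n : ℕ) (hn : 1 ≤ n) (t : ℕ) (ht : 1 ≤ t)
    (J : Finset ℕ) (hJ : ∀ i ∈ J, 1 ≤ i ∧ i < n) :
    betaT
        (fun X : SegrePower (fun W : Submodule F (Fin n → F) => Module.finrank F W) t =>
          Module.finrank F (X.1 ⟨0, ht⟩))
        (⟨fun _ => (⊥ : Submodule F (Fin n → F)), fun _ _ => rfl⟩ :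
          SegrePower (fun W : Submodule F (Fin n → F) => Module.finrank F W) t)
        (⟨fun _ => (⊤ : Submodule F (Fin n → F)), fun _ _ => rfl⟩ :
          SegrePower (fun W : Submodule F (Fin n → F) => Module.finrank F W) t) J =
      ∑ σt : Fin t → Equiv.Perm (Fin n),
        if (⋂ j : Fin t, permAsc (σt j)) = {i : ℕ | 1 ≤ i ∧ i < n} \ ↑J then
          ∏ j : Fin t, (q : ℤ) ^ permInv (σt j)
        else 0 := by

  have hrank : Module.finrank F (Fin n → F) = n := Module.finrank_fin_fun F
  have halpha : ∀ U ∈ J.powerset, (-1 : ℤ) ^ (J.card - U.card) * (alphaT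
        (fun X : SegrePower (fun W : Submodule F (Fin n → F) => Module.finrank F W) t =>
          Module.finrank F (X.1 ⟨0, ht⟩))
        ⟨fun _ => (⊥ : Submodule F (Fin n → F)), fun _ _ => rfl⟩
        ⟨fun _ => (⊤ : Submodule F (Fin n → F)), fun _ _ => rfl⟩ U : ℤ) =
      ∑ σ : Fin t → Equiv.Perm (Fin n), (∏ j, (q : ℤ) ^ permInv (σ j)) *
        ((-1 : ℤ) ^ (J.card - U.card) * if jointDescents σ ⊆ U then 1 else 0) := fun U hU => by
    rw [alphaT_segrePower ht (hn.trans_eq hrank.symm) (fun u hu => by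
      rw [hrank]
      exact hJ u (Finset.mem_powerset.1 hU hu)), hrank, hq, descentGenFun_pow, Finset.mul_sum]
    exact Finset.sum_congr rfl fun σ _ => mul_left_comm _ _ _
  rw [betaT, Finset.sum_congr rfl halpha, Finset.sum_comm]
  refine Finset.sum_congr rfl fun σ _ => ?_
  rw [← Finset.mul_sum, sum_powerset_neg_one_pow_of_subset]
  simp only [iInter_permAsc_eq_iff ht σ hJ, mul_ite, mul_one, mul_zero]
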